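/- The family {Y_d : d ∈ ℤ, −2 ≤ d ≤ 2} ∪ {Y₃ − Y_{−3}} ∪ {γ_a : a ∈ ℤ} is a ℚ-basis of Y = ℤ →₀ ℚ. -/

import Mathlib

noncomputable section

abbrev Ysp : Type := ℤ →₀ ℚ

/-- The basis vector `Y_d` of `Y`. -/
def YB (d : ℤ) : Ysp := Finsupp.single d 1

/-- `γ_a = (-(a-3)/2)·Y_{a-3} + (3(a-1)/2)·Y_{a-1} + (-3(a+1)/2)·Y_{a+1} + ((a+3)/2)·Y_{a+3}`. -/
def gammaY (a : ℤ) : Ysp :=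
  (-((a : ℚ) - 3) / 2) • YB (a - 3) + (3 * ((a : ℚ) - 1) / 2) • YB (a - 1)
    + (-(3 * ((a : ℚ) + 1)) / 2) • YB (a + 1) + (((a : ℚ) + 3) / 2) • YB (a + 3)

/-- The family consisting of `Y_d` for `-2 ≤ d ≤ 2`, `Y_3 - Y_{-3}` and all the `γ_a`. -/
abbrev gammaFamily : {d : ℤ // -2 ≤ d ∧ d ≤ 2} ⊕ (Unit ⊕ ℤ) → Ysp :=
  Sum.elim (fun d : {d : ℤ // -2 ≤ d ∧ d ≤ 2} => YB d.1)
    (Sum.elim (fun _ : Unit => YB 3 - YB (-3)) gammaY)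

theorem gammaY_apply (a n : ℤ) :
    gammaY a n = (n : ℚ) / 2 * ((if a = n - 3 then 1 else 0) - 3 * (if a = n - 1 then 1 else 0)
      + 3 * (if a = n + 1 then 1 else 0) - (if a = n + 3 then 1 else 0)) := by
  have shift_iff (k : ℤ) : a + k = n ↔ a = n - k := by omega
  have shift_iff' (k : ℤ) : a - k = n ↔ a = n + k := by omega
  simp only [gammaY, YB, Finsupp.add_apply, Finsupp.smul_apply, Finsupp.single_apply, smul_eq_mul,
    shift_iff, shift_iff']
  split_ifs <;> first | omega | (subst_vars; push_cast; ring)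

theorem linearCombination_gammaFamily_apply
    (l : {d : ℤ // -2 ≤ d ∧ d ≤ 2} ⊕ (Unit ⊕ ℤ) →₀ ℚ) (n : ℤ) :
    Finsupp.linearCombination ℚ gammaFamily l n =
      (if h : -2 ≤ n ∧ n ≤ 2 then l (.inl ⟨n, h⟩) else 0)
      + l (.inr (.inl ())) * ((if n = 3 then 1 else 0) - (if n = -3 then 1 else 0))
      + (n : ℚ) / 2 * (l (.inr (.inr (n - 3))) - 3 * l (.inr (.inr (n - 1)))
        + 3 * l (.inr (.inr (n + 1))) - l (.inr (.inr (n + 3)))) := by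
  induction l using Finsupp.induction_linear with
  | zero => simp
  | add f g hf hg =>
    rw [map_add, Finsupp.add_apply, hf, hg]
    simp only [Finsupp.add_apply]
    split_ifs <;> ring
  | single i c =>
    rw [Finsupp.linearCombination_single, Finsupp.smul_apply]
    rcases i with ⟨d, hd⟩ | u | a
    · by_cases h : d = n
      · subst h
        simp [YB, hd]
      · simp [YB, h]
    · simp [YB, Finsupp.single_apply, eq_comm]
    · simp only [gammaFamily, Sum.elim_inr, gammaY_apply, Finsupp.single_apply, Sum.inr.injEq,
        reduceCtorEq, smul_eq_mul, if_false, dite_eq_ite, ite_self]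
      split_ifs <;> ring

theorem Finsupp.eq_zero_of_forall_gt {c : ℤ →₀ ℚ} {m : ℤ}
    (h : ∀ a ≥ m, (∀ b > a, c b = 0) → c a = 0) {a : ℤ} (ha : m ≤ a) : c a = 0 := by
  by_contra hne
  have hmem : a ∈ c.support.filter (m ≤ ·) := by simp [hne, ha]
  obtain ⟨x, hx, hmax⟩ := Finset.exists_max_image _ id ⟨a, hmem⟩
  simp only [Finset.mem_filter, Finsupp.mem_support_iff, id] at hx hmax
  refine hx.1 (h x hx.2 fun b hb => ?_)
  by_contra hcb
  have := hmax b ⟨hcb, by omega⟩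
  omega

theorem Finsupp.eq_zero_of_forall_lt {c : ℤ →₀ ℚ} {m : ℤ}
    (h : ∀ a ≤ m, (∀ b < a, c b = 0) → c a = 0) {a : ℤ} (ha : a ≤ m) : c a = 0 := by
  by_contra hne
  have hmem : a ∈ c.support.filter (· ≤ m) := by simp [hne, ha]
  obtain ⟨x, hx, hmin⟩ := Finset.exists_min_image _ id ⟨a, hmem⟩
  simp only [Finset.mem_filter, Finsupp.mem_support_iff, id] at hx hmin
  refine hx.1 (h x hx.2 fun b hb => ?_)
  by_contra hcb
  have := hmin b ⟨hcb, by omega⟩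
  omega

theorem linearIndependent_gammaFamily : LinearIndependent ℚ gammaFamily := by
  rw [linearIndependent_iff]
  intro l hl
  obtain ⟨c, hc⟩ : ∃ c : ℤ →₀ ℚ, ∀ a, l (.inr (.inr a)) = c a :=
    ⟨l.comapDomain (fun a => .inr (.inr a)) (by intro; simp), fun a => rfl⟩
  have key (n : ℤ) := linearCombination_gammaFamily_apply l n
  simp only [hl, Finsupp.coe_zero, Pi.zero_apply, hc] at key
  have hpos {a : ℤ} (ha : 1 ≤ a) : c a = 0 := by
    refine Finsupp.eq_zero_of_forall_gt (fun a ha hb => ?_) ha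
    have hk := key (a + 3)
    rw [dif_neg (by omega), if_neg (by omega), if_neg (by omega), hb (a + 3 - 1) (by omega),
      hb (a + 3 + 1) (by omega), hb (a + 3 + 3) (by omega), add_sub_cancel_right] at hk
    have hne : (a : ℚ) + 3 ≠ 0 := by exact_mod_cast (by omega : a + 3 ≠ 0)
    simpa [hne] using hk.symm
  have hneg {a : ℤ} (ha : a ≤ -1) : c a = 0 := by
    refine Finsupp.eq_zero_of_forall_lt (fun a ha hb => ?_) ha
    have hk := key (a - 3)
    rw [dif_neg (by omega), if_neg (by omega), if_neg (by omega), hb (a - 3 - 1) (by omega),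
      hb (a - 3 + 1) (by omega), hb (a - 3 - 3) (by omega), sub_add_cancel] at hk
    have hne : (a : ℚ) - 3 ≠ 0 := by exact_mod_cast (by omega : a - 3 ≠ 0)
    simpa [hne] using hk.symm
  have h3 := key 3
  have h3' := key (-3)
  norm_num [hpos, hneg] at h3 h3'
  have hzero (a : ℤ) : c a = 0 := by
    rcases lt_trichotomy a 0 with h | rfl | h
    · exact hneg (by omega)
    · linarith
    · exact hpos (by omega)
  ext (⟨d, hd⟩ | u | a)
  · have hk := key d
    rw [dif_pos hd, if_neg (by omega), if_neg (by omega)] at hk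
    simpa [hzero] using hk.symm
  · simp only [Finsupp.coe_zero, Pi.zero_apply]
    linarith
  · rw [hc, hzero, Finsupp.coe_zero, Pi.zero_apply]

theorem YB_mem_span_gammaFamily (d : ℤ) :
    YB d ∈ Submodule.span ℚ (Set.range gammaFamily) := by
  set S := Submodule.span ℚ (Set.range gammaFamily)
  have hfam (i) : gammaFamily i ∈ S := Submodule.subset_span ⟨i, rfl⟩
  have hsmall {d : ℤ} (h : -2 ≤ d ∧ d ≤ 2) : YB d ∈ S := hfam (.inl ⟨d, h⟩)
  have hdiff : YB 3 - YB (-3) ∈ S := hfam (.inr (.inl ()))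
  have hgamma (a : ℤ) : gammaY a ∈ S := hfam (.inr (.inr a))
  have hthree : YB 3 ∈ S := by
    have h : YB 3 = (1 / 3 : ℚ) • gammaY 0 + (1 / 2 : ℚ) • (YB 3 - YB (-3))
        + (1 / 2 : ℚ) • (YB (-1) + YB 1) := by
      norm_num [gammaY]
      module
    rw [h]
    exact add_mem (add_mem (S.smul_mem _ (hgamma 0)) (S.smul_mem _ hdiff))
      (S.smul_mem _ (add_mem (hsmall (by norm_num)) (hsmall (by norm_num))))
  induction hn : d.natAbs using Nat.strong_induction_on generalizing d with
  | _ n ih =>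
  subst hn
  have ih {e : ℤ} (he : e.natAbs < d.natAbs) (c : ℚ) : c • YB e ∈ S :=
    S.smul_mem c (ih _ he e rfl)
  by_cases h : -2 ≤ d ∧ d ≤ 2
  · exact hsmall h
  have hd : (d : ℚ) / 2 ≠ 0 := by
    have : (d : ℚ) ≠ 0 := by exact_mod_cast (by omega : d ≠ 0)
    positivity
  by_cases h4 : 4 ≤ d
  · have hg := hgamma (d - 3)
    rw [gammaY, S.add_mem_iff_right (add_mem (add_mem (ih (by omega) _) (ih (by omega) _))
      (ih (by omega) _))] at hg
    simpa [Submodule.smul_mem_iff _ hd] using hg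
  by_cases h4' : d ≤ -4
  · have hg := hgamma (d + 3)
    rw [gammaY, add_assoc, add_assoc, S.add_mem_iff_left (add_mem (ih (by omega) _)
      (add_mem (ih (by omega) _) (ih (by omega) _)))] at hg
    simpa [neg_div, Submodule.smul_mem_iff _ hd] using hg
  obtain rfl | rfl : d = 3 ∨ d = -3 := by omega
  · exact hthree
  · simpa using sub_mem hthree hdiff

theorem span_gammaFamily : Submodule.span ℚ (Set.range gammaFamily) = ⊤ := by
  rw [eq_top_iff]
  intro f _
  induction f using Finsupp.induction_linear with
  | zero => exact zero_mem _
  | add f g hf hg => exact add_mem (hf trivial) (hg trivial)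
  | single d c => simpa [YB] using Submodule.smul_mem _ c (YB_mem_span_gammaFamily d)

theorem stmt5 :
    LinearIndependent ℚ
      (Sum.elim (fun d : {d : ℤ // -2 ≤ d ∧ d ≤ 2} => YB d.1)
        (Sum.elim (fun _ : Unit => YB 3 - YB (-3)) gammaY)) ∧
    Submodule.span ℚ
      (Set.range (Sum.elim (fun d : {d : ℤ // -2 ≤ d ∧ d ≤ 2} => YB d.1)
        (Sum.elim (fun _ : Unit => YB 3 - YB (-3)) gammaY))) = ⊤ := by
  exact ⟨linearIndependent_gammaFamily, span_gammaFamily⟩
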